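/- arXiv:2503.12811 — 2 statements merged into one kernel-verified Lean document; each statement's English description precedes it below -/
import Mathlib

section
/- For every x ∈ [0,1]: there exists ξ_1 ∈ [-10, 0] such that (1-x)² = exp(-2x)·(1 + ξ_1 x²), and there exists ξ_2 ∈ [-10, 0] such that (1-2x) = exp(-2x)·(1 + ξ_2 x²). -/
/-- The chord bound for the convex function `exp (2 * x)` on `[0, 1]`, using `exp 2 ≤ 8`. -/
lemma exp_two_mul_le_one_add {x : ℝ} (h0 : 0 ≤ x) (h1 : x ≤ 1) :
    Real.exp (2 * x) ≤ 1 + 7 * x := by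
  have hconv := convexOn_exp.2 (Set.mem_univ (0 : ℝ)) (Set.mem_univ (2 : ℝ))
    (sub_nonneg.2 h1) h0 (by ring)
  simp only [smul_eq_mul, mul_zero, zero_add, Real.exp_zero, mul_one] at hconv
  rw [mul_comm x 2] at hconv
  have hexp : Real.exp 2 ≤ 8 := by
    have hsq : Real.exp 2 = Real.exp 1 * Real.exp 1 := by
      rw [← Real.exp_add]; norm_num
    nlinarith [Real.exp_one_lt_d9, Real.exp_pos 1]
  nlinarith

lemma one_sub_ten_mul_sq_le {x : ℝ} (h0 : 0 ≤ x) (h1 : x ≤ 1) :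
    1 - 10 * x ^ 2 ≤ (1 - 2 * x) * Real.exp (2 * x) := by
  rcases le_total (2 * x) 1 with h | h
  · nlinarith [mul_le_mul_of_nonneg_left (Real.add_one_le_exp (2 * x)) (sub_nonneg.2 h)]
  · nlinarith [mul_le_mul_of_nonneg_left (exp_two_mul_le_one_add h0 h1) (sub_nonneg.2 h)]

lemma one_sub_sq_mul_exp_le_one {x : ℝ} (h1 : x ≤ 1) :
    (1 - x) ^ 2 * Real.exp (2 * x) ≤ 1 := by
  have hle : (1 - x) ^ 2 ≤ Real.exp (-x) ^ 2 :=
    pow_le_pow_left₀ (sub_nonneg.2 h1) (Real.one_sub_le_exp_neg x) 2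
  calc (1 - x) ^ 2 * Real.exp (2 * x) ≤ Real.exp (-x) ^ 2 * Real.exp (2 * x) := by gcongr
    _ = 1 := by
      rw [sq, ← Real.exp_add, ← Real.exp_add, ← Real.exp_zero]
      ring_nf

/-- Every `a` between `1 - 2 * x` and `(1 - x) ^ 2` is `exp (-2 * x)` up to a factor
`1 + ξ * x ^ 2` with `ξ ∈ [-10, 0]`. -/
lemma exists_eq_exp_mul_one_add {x a : ℝ} (h0 : 0 ≤ x) (h1 : x ≤ 1)
    (hl : 1 - 2 * x ≤ a) (hu : a ≤ (1 - x) ^ 2) :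
    ∃ ξ ∈ Set.Icc (-10 : ℝ) 0, a = Real.exp (-2 * x) * (1 + ξ * x ^ 2) := by
  rcases h0.eq_or_lt with rfl | hpos
  · refine ⟨0, by norm_num, ?_⟩
    norm_num at hl hu ⊢
    exact le_antisymm hu hl
  have hx2 : 0 < x ^ 2 := by positivity
  have hlow : 1 - 10 * x ^ 2 ≤ a * Real.exp (2 * x) :=
    (one_sub_ten_mul_sq_le h0 h1).trans (by gcongr)
  have hup : a * Real.exp (2 * x) ≤ 1 :=
    le_trans (by gcongr) (one_sub_sq_mul_exp_le_one h1)
  refine ⟨(a * Real.exp (2 * x) - 1) / x ^ 2, ⟨?_, ?_⟩, ?_⟩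
  · rw [le_div_iff₀ hx2]; linarith
  · exact div_nonpos_of_nonpos_of_nonneg (by linarith) hx2.le
  · rw [div_mul_cancel₀ _ hx2.ne', add_sub_cancel, mul_left_comm, ← Real.exp_add]
    simp

/-- For every `x ∈ [0,1]`: there exists `ξ₁ ∈ [-10, 0]` such that
`(1-x)² = exp(-2x)·(1 + ξ₁ x²)`, and there exists `ξ₂ ∈ [-10, 0]` such that
`(1-2x) = exp(-2x)·(1 + ξ₂ x²)`. -/
theorem stmt_3 (x : ℝ) (hx : x ∈ Set.Icc (0:ℝ) 1) :
    (∃ ξ₁ ∈ Set.Icc (-10:ℝ) 0, (1 - x) ^ 2 = Real.exp (-2 * x) * (1 + ξ₁ * x ^ 2)) ∧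
    (∃ ξ₂ ∈ Set.Icc (-10:ℝ) 0, 1 - 2 * x = Real.exp (-2 * x) * (1 + ξ₂ * x ^ 2)) := by
  have hle : 1 - 2 * x ≤ (1 - x) ^ 2 := by nlinarith [sq_nonneg x]
  exact ⟨exists_eq_exp_mul_one_add hx.1 hx.2 hle le_rfl,
    exists_eq_exp_mul_one_add hx.1 hx.2 le_rfl hle⟩
end

section
/- Let Λ > 0, ν ∈ [0,1), ρ < 1 - ν, r > 0, F > 0, μ > 0, and let (λ, Σ) be a pair of random variables such that λ has density p(λ) = λ^{-ν}/Z on [0, Λ] (with normalization Z = ∫_0^Λ λ^{-ν} dλ) and E[Σ | λ] = F μ λ^{-ρ} exp(-rλ). Then for every S ≥ 0, with β := 1 - ν - ρ, E[Σ exp(-2λS)] = (Fμ/Z) · γ(β, (2S + r)Λ) · (2S + r)^{-β}, where γ(s,y) = ∫_0^y u^{s-1} e^{-u} du is the lower incomplete gamma function. In particular, taking S = 0, the consistency condition E[Σ] = μ forces F = Z r^{β} / γ(β, rΛ). -/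
open MeasureTheory

/-- The lower incomplete gamma function `γ(s, x) = ∫_0^x u^{s-1} e^{-u} du`. -/
noncomputable def lowerIncompleteGamma (s x : ℝ) : ℝ :=
  ∫ u in (0:ℝ)..x, u ^ (s - 1) * Real.exp (-u)

/-- Rescaling the truncated Laplace transform of a power law to the incomplete gamma function. -/
theorem integral_rpow_mul_exp_neg_mul {c : ℝ} (hc : 0 < c) (s : ℝ) {Λ : ℝ} (hΛ : 0 ≤ Λ) :
    ∫ l in (0:ℝ)..Λ, l ^ (s - 1) * Real.exp (-(c * l))
      = lowerIncompleteGamma s (c * Λ) * c ^ (-s) := by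
  have hscale := intervalIntegral.integral_comp_mul_left
    (a := 0) (b := Λ) (fun u : ℝ => u ^ (s - 1) * Real.exp (-u)) hc.ne'
  have hfactor : ∫ l in (0:ℝ)..Λ, (c * l) ^ (s - 1) * Real.exp (-(c * l))
      = c ^ (s - 1) * ∫ l in (0:ℝ)..Λ, l ^ (s - 1) * Real.exp (-(c * l)) := by
    rw [← intervalIntegral.integral_const_mul]
    refine intervalIntegral.integral_congr fun l hl => ?_
    rw [Set.uIcc_of_le hΛ] at hl
    simp only [Real.mul_rpow hc.le hl.1, mul_assoc]
  rw [hfactor, mul_zero, smul_eq_mul] at hscale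
  have hpos : 0 < c ^ (s - 1) := Real.rpow_pos_of_pos hc _
  have hinv : c ^ (-s) * c ^ (s - 1) = c⁻¹ := by
    rw [← Real.rpow_add hc, ← Real.rpow_neg_one]
    ring_nf
  apply mul_left_cancel₀ hpos.ne'
  rw [hscale, lowerIncompleteGamma, ← hinv]
  ring

/-- A function whose conditional expectation is not almost everywhere zero is integrable. -/
theorem integrable_of_condExp_ae_ne_zero {Ω : Type*} {m m₀ : MeasurableSpace Ω} {μ : Measure Ω}
    [NeZero μ] {f : Ω → ℝ} (h : ∀ᵐ ω ∂μ, (μ[f | m]) ω ≠ 0) : Integrable f μ := by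
  by_contra hf
  rw [condExp_of_not_integrable hf] at h
  obtain ⟨ω, hω⟩ := h.exists
  exact hω rfl

/-- The pull-out property, integrated. -/
theorem integral_mul_eq_integral_condExp_mul {Ω : Type*} {m m₀ : MeasurableSpace Ω}
    {μ : Measure Ω} (hm : m ≤ m₀) [SigmaFinite (μ.trim hm)] {f g : Ω → ℝ}
    (hg : StronglyMeasurable[m] g) (hfg : Integrable (f * g) μ) (hf : Integrable f μ) :
    ∫ ω, f ω * g ω ∂μ = ∫ ω, (μ[f | m]) ω * g ω ∂μ := by
  have hpull := condExp_mul_of_stronglyMeasurable_right hg hfg hf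
  calc ∫ ω, f ω * g ω ∂μ = ∫ ω, (μ[f * g | m]) ω ∂μ := (integral_condExp hm).symm
    _ = ∫ ω, (μ[f | m]) ω * g ω ∂μ := integral_congr_ae hpull

/-- If `λ` has density `λ^{-ν}/Z` on `[0,Λ]` (with `Z = ∫_0^Λ λ^{-ν} dλ`) and
`E[Σ | λ] = F μ λ^{-ρ} exp(-rλ)`, then for every `S ≥ 0`, with `β = 1 - ν - ρ`,
`E[Σ exp(-2λS)] = (Fμ/Z) γ(β, (2S+r)Λ) (2S+r)^{-β}`; in particular the consistency
condition `E[Σ] = μ` forces `F = Z r^β / γ(β, rΛ)`. -/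
theorem stmt_16
    (Λ ν ρ r F μm : ℝ) (hΛ : 0 < Λ) (hν0 : 0 ≤ ν) (hν1 : ν < 1)
    (hρ : ρ < 1 - ν) (hr : 0 < r) (hF : 0 < F) (hμm : 0 < μm)
    (Z : ℝ) (hZ : Z = ∫ l in (0:ℝ)..Λ, l ^ (-ν))
    (Ω : Type) [MeasurableSpace Ω] (μ : Measure Ω) [IsProbabilityMeasure μ]
    (lam Sig : Ω → ℝ) (hlam : Measurable lam) (hSig : Measurable Sig)
    (hlamLaw : μ.map lam = (volume.restrict (Set.Icc 0 Λ)).withDensity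
        (fun l => ENNReal.ofReal (l ^ (-ν) / Z)))
    (hSigCond : μ[Sig | MeasurableSpace.comap lam inferInstance]
        =ᵐ[μ] fun ω => F * μm * lam ω ^ (-ρ) * Real.exp (-r * lam ω)) :
    (∀ S : ℝ, 0 ≤ S →
      ∫ ω, Sig ω * Real.exp (-2 * lam ω * S) ∂μ
        = (F * μm / Z) * lowerIncompleteGamma (1 - ν - ρ) ((2 * S + r) * Λ)
            * (2 * S + r) ^ (-(1 - ν - ρ))) ∧
    ((∫ ω, Sig ω ∂μ) = μm →
      F = Z * r ^ (1 - ν - ρ) / lowerIncompleteGamma (1 - ν - ρ) (r * Λ)) := by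
  have hZpos : 0 < Z := by
    rw [hZ, integral_rpow (Or.inl (by linarith)), Real.zero_rpow (by linarith), sub_zero]
    exact div_pos (Real.rpow_pos_of_pos hΛ _) (by linarith)
  have hlam_pos : ∀ᵐ ω ∂μ, 0 < lam ω := by
    refine ae_of_ae_map hlam.aemeasurable ?_
    rw [hlamLaw]
    refine (withDensity_absolutelyContinuous _ _).ae_le ?_
    rw [← restrict_Ioc_eq_restrict_Icc]
    filter_upwards [ae_restrict_mem measurableSet_Ioc] with l hl using hl.1
  have hm : MeasurableSpace.comap lam inferInstance ≤ (inferInstance : MeasurableSpace Ω) :=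
    hlam.comap_le
  have hSig_int : Integrable Sig μ := by
    apply integrable_of_condExp_ae_ne_zero (m := MeasurableSpace.comap lam inferInstance)
    filter_upwards [hSigCond, hlam_pos] with ω hω hpos
    rw [hω]
    have := Real.rpow_pos_of_pos hpos (-ρ)
    positivity
  have hmain : ∀ S : ℝ, 0 ≤ S →
      ∫ ω, Sig ω * Real.exp (-2 * lam ω * S) ∂μ
        = (F * μm / Z) * lowerIncompleteGamma (1 - ν - ρ) ((2 * S + r) * Λ)
            * (2 * S + r) ^ (-(1 - ν - ρ)) := by
    intro S hS
    have hexp : Measurable fun l : ℝ => Real.exp (-2 * l * S) := by fun_prop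
    have hweight : StronglyMeasurable[MeasurableSpace.comap lam inferInstance]
        fun ω => Real.exp (-2 * lam ω * S) :=
      (hexp.comp (comap_measurable lam)).stronglyMeasurable
    have hprod : Integrable (Sig * fun ω => Real.exp (-2 * lam ω * S)) μ := by
      refine hSig_int.mul_bdd (c := 1) (hexp.comp hlam).aestronglyMeasurable ?_
      filter_upwards [hlam_pos] with ω hω
      rw [Real.norm_eq_abs, Real.abs_exp, Real.exp_le_one_iff]
      nlinarith [mul_nonneg hω.le hS]
    have hmeas : Measurable fun l : ℝ =>
        F * μm * l ^ (-ρ) * Real.exp (-r * l) * Real.exp (-2 * l * S) := by fun_prop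
    calc ∫ ω, Sig ω * Real.exp (-2 * lam ω * S) ∂μ
        = ∫ ω, F * μm * lam ω ^ (-ρ) * Real.exp (-r * lam ω) * Real.exp (-2 * lam ω * S) ∂μ := by
          rw [integral_mul_eq_integral_condExp_mul hm hweight hprod hSig_int]
          refine integral_congr_ae ?_
          filter_upwards [hSigCond] with ω hω
          rw [hω]
      _ = ∫ l, F * μm * l ^ (-ρ) * Real.exp (-r * l) * Real.exp (-2 * l * S) ∂(μ.map lam) :=
          (integral_map hlam.aemeasurable hmeas.aestronglyMeasurable).symm
      _ = ∫ l in Set.Ioc 0 Λ, (l ^ (-ν) / Z) *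
            (F * μm * l ^ (-ρ) * Real.exp (-r * l) * Real.exp (-2 * l * S)) := by
          rw [hlamLaw, restrict_Ioc_eq_restrict_Icc.symm,
            integral_withDensity_eq_integral_toReal_smul (by fun_prop) (by simp)]
          refine setIntegral_congr_fun measurableSet_Ioc fun l hl => ?_
          have := Real.rpow_pos_of_pos hl.1 (-ν)
          simp only [smul_eq_mul, ENNReal.toReal_ofReal (show 0 ≤ l ^ (-ν) / Z by positivity)]
      _ = ∫ l in Set.Ioc 0 Λ, (F * μm / Z) *
            (l ^ (1 - ν - ρ - 1) * Real.exp (-((2 * S + r) * l))) := by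
          refine setIntegral_congr_fun measurableSet_Ioc fun l hl => ?_
          have hpow : l ^ (1 - ν - ρ - 1) = l ^ (-ν) * l ^ (-ρ) := by
            rw [← Real.rpow_add hl.1]
            ring_nf
          have hsum : Real.exp (-((2 * S + r) * l))
              = Real.exp (-r * l) * Real.exp (-2 * l * S) := by
            rw [← Real.exp_add]
            ring_nf
          simp only [hpow, hsum]
          ring
      _ = _ := by
          rw [integral_const_mul, ← intervalIntegral.integral_of_le hΛ.le,
            integral_rpow_mul_exp_neg_mul (by linarith) _ hΛ.le, mul_assoc]
  refine ⟨hmain, fun hmean => ?_⟩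
  have hzero := hmain 0 le_rfl
  simp only [mul_zero, Real.exp_zero, mul_one, zero_add, hmean, Real.rpow_neg hr.le] at hzero
  have hrpow : 0 < r ^ (1 - ν - ρ) := Real.rpow_pos_of_pos hr _
  have hγ : lowerIncompleteGamma (1 - ν - ρ) (r * Λ) ≠ 0 := by
    intro h
    rw [h] at hzero
    simp only [mul_zero, zero_mul] at hzero
    exact hμm.ne' hzero
  field_simp at hzero ⊢
  linarith
end
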